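/- Let p be an odd prime and let A₁, A₂ ∈ ℤ/pℤ be nonzero with A₁ ≠ A₂; let L := {(a₁, a₂) ∈ ℤ² | a₁ • A₁ + a₂ • A₂ = 0 in ℤ/pℤ}. If a, b ∈ L are ℤ-linearly independent, nonnegative, and each of degree ≤ d, then p ≤ (d − 1)². (Equivalently, the full-rank degree of L — hence β_field(ℤ/pℤ, V) = γ_field(ℤ/pℤ, V) for V with two distinct nontrivial characters — is at least ⌈√p + 1⌉.) -/

import Mathlib

/-- Two vectors annihilated by the same `(A, B)` with `A ≠ 0` have determinant divisible by `p`. -/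
lemma dvd_det_of_mul_add_mul_eq_zero {p : ℕ} [Fact p.Prime] {A B : ZMod p} (hA : A ≠ 0)
    {x y z w : ℤ} (h : (x : ZMod p) * A + y * B = 0) (h' : (z : ZMod p) * A + w * B = 0) :
    (p : ℤ) ∣ x * w - y * z := by
  rw [← ZMod.intCast_zmod_eq_zero_iff_dvd]
  refine (mul_eq_zero.mp ?_).resolve_right hA
  push_cast
  linear_combination (w : ZMod p) * h - (y : ZMod p) * h'

lemma le_sub_one_sq_of_le {p d : ℤ} (hp : 3 ≤ p) (hd : p ≤ d) : p ≤ (d - 1) ^ 2 := by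
  nlinarith

/-- A positive determinant of nonnegative vectors of degree at most `d` whose entries on the
coordinate axes are multiples of `p` bounds `p` by `(d - 1) ^ 2`. -/
lemma le_sub_one_sq_of_dvd_det {p d x y z w : ℤ} (hp : 3 ≤ p)
    (hx : 0 ≤ x) (hy : 0 ≤ y) (hz : 0 ≤ z) (hw : 0 ≤ w) (hxy : x + y ≤ d) (hzw : z + w ≤ d)
    (hy0 : y = 0 → p ∣ x) (hz0 : z = 0 → p ∣ w)
    (hdvd : p ∣ x * w - y * z) (hpos : 0 < x * w - y * z) : p ≤ (d - 1) ^ 2 := by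
  have hxw : 0 < x * w := by nlinarith [mul_nonneg hy hz]
  have hx' : 0 < x := hx.lt_of_ne (by rintro rfl; simp at hxw)
  have hw' : 0 < w := hw.lt_of_ne (by rintro rfl; simp at hxw)
  rcases hy.eq_or_lt with h | h
  · have := Int.le_of_dvd hx' (hy0 h.symm)
    exact le_sub_one_sq_of_le hp (by linarith)
  rcases hz.eq_or_lt with h' | h'
  · have := Int.le_of_dvd hw' (hz0 h'.symm)
    exact le_sub_one_sq_of_le hp (by linarith)
  have hle := Int.le_of_dvd hpos hdvd
  have : x * w ≤ (d - 1) * (d - 1) :=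
    mul_le_mul (by linarith) (by linarith) hw (by linarith)
  nlinarith [mul_nonneg hy hz]

lemma det_ne_zero_of_linearIndependent_pair {a b : Fin 2 → ℤ}
    (h : LinearIndependent ℤ ![a, b]) : a 0 * b 1 - a 1 * b 0 ≠ 0 := by
  intro hD
  rw [LinearIndependent.pair_iff] at h
  have ha1 := (h (b 1) (-a 1) (by
    ext i; fin_cases i <;> simp <;> linarith)).2
  have ha0 := (h (b 0) (-a 0) (by
    ext i; fin_cases i <;> simp <;> linarith)).2
  have := (h 1 0 (by
    ext i; fin_cases i <;> simp <;> linarith)).1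
  exact one_ne_zero this


/-- Let `p` be an odd prime, `A₁, A₂ ∈ ℤ/pℤ` nonzero and distinct, and
`L = {(a₁,a₂) ∈ ℤ² | a₁ • A₁ + a₂ • A₂ = 0}`. If `a, b ∈ L` are `ℤ`-linearly independent,
nonnegative, each of degree `≤ d`, then `p ≤ (d − 1)²`. -/
theorem stmt_13 (p : ℕ) (hp : p.Prime) (hp2 : p ≠ 2) (A₁ A₂ : ZMod p)
    (h1 : A₁ ≠ 0) (h2 : A₂ ≠ 0) (hne : A₁ ≠ A₂)
    (d : ℕ) (a b : Fin 2 → ℤ)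
    (ha : a 0 • A₁ + a 1 • A₂ = 0) (hb : b 0 • A₁ + b 1 • A₂ = 0)
    (hind : LinearIndependent ℤ ![a, b])
    (hapos : ∀ i, 0 ≤ a i) (hbpos : ∀ i, 0 ≤ b i)
    (hadeg : a 0 + a 1 ≤ (d : ℤ)) (hbdeg : b 0 + b 1 ≤ (d : ℤ)) :
    (p : ℤ) ≤ ((d : ℤ) - 1) ^ 2 := by
  have : Fact p.Prime := ⟨hp⟩
  have hp3 : (3 : ℤ) ≤ p := by
    have := hp.two_le
    omega
  rw [zsmul_eq_mul, zsmul_eq_mul] at ha hb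
  have hdvd := dvd_det_of_mul_add_mul_eq_zero h1 ha hb
  have axis0 : ∀ x y : ℤ, (x : ZMod p) * A₁ + y * A₂ = 0 → y = 0 → (p : ℤ) ∣ x := by
    rintro x _ h rfl
    rw [← ZMod.intCast_zmod_eq_zero_iff_dvd]
    simpa [h1] using h
  have axis1 : ∀ x y : ℤ, (x : ZMod p) * A₁ + y * A₂ = 0 → x = 0 → (p : ℤ) ∣ y := by
    rintro _ y h rfl
    rw [← ZMod.intCast_zmod_eq_zero_iff_dvd]
    simpa [h2] using h
  rcases (det_ne_zero_of_linearIndependent_pair hind).lt_or_gt with hneg | hpos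
  · have hswap : b 0 * a 1 - b 1 * a 0 = -(a 0 * b 1 - a 1 * b 0) := by ring
    exact le_sub_one_sq_of_dvd_det hp3 (hbpos 0) (hbpos 1) (hapos 0) (hapos 1) hbdeg hadeg
      (axis0 _ _ hb) (axis1 _ _ ha) (hswap ▸ hdvd.neg_right) (by linarith)
  · exact le_sub_one_sq_of_dvd_det hp3 (hapos 0) (hapos 1) (hbpos 0) (hbpos 1) hadeg hbdeg
      (axis0 _ _ ha) (axis1 _ _ hb) hdvd hpos
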